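/- Let Δ ≥ 2 and n be positive integers, α > 0, and let d be a real number with d ≥ 2αΔ + 2√Δ/log₂Δ. Let H_A be an r_A×Δ matrix over F₂ such that the code C_A = ker H_A has minimum distance d_A ≥ d. Let X be a Δ×n matrix over F₂ all of whose columns have Hamming weight at most √Δ/log₂Δ, and suppose at least d/2 of the rows of X are nonzero. Then the rank of H_A·X over F₂ is at least α·√Δ·log₂Δ. -/

import Mathlib

noncomputable section

/-- Hamming weight of a binary word. -/
def wt {ι : Type*} (x : ι → ZMod 2) : ℕ := {i | x i ≠ 0}.ncard

/-- Hamming distance from a word to a set of words. -/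
def distTo {ι : Type*} (x : ι → ZMod 2) (S : Set (ι → ZMod 2)) : ℕ :=
  sInf {d : ℕ | ∃ c ∈ S, wt (x - c) = d}

/-- Minimum distance of a linear code. -/
def minDist {ι : Type*} (C : Submodule (ZMod 2) (ι → ZMod 2)) : ℕ :=
  sInf {d : ℕ | ∃ c ∈ C, c ≠ 0 ∧ wt c = d}

/-- Dual code with respect to the standard bilinear form. -/
def dualCode {ι : Type*} [Finite ι] (C : Submodule (ZMod 2) (ι → ZMod 2)) :
    Submodule (ZMod 2) (ι → ZMod 2) :=
  letI := Fintype.ofFinite ι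
  { carrier := {x | ∀ c ∈ C, ∑ i, x i * c i = 0}
    add_mem' := by
      intro x y hx hy c hc
      have h : ∑ i, (x + y) i * c i = (∑ i, x i * c i) + ∑ i, y i * c i := by
        simp [add_mul, Finset.sum_add_distrib]
      simp only [Set.mem_setOf_eq] at *
      rw [h, hx c hc, hy c hc, add_zero]
    zero_mem' := by
      simp
    smul_mem' := by
      intro t x hx c hc
      have h : ∑ i, (t • x) i * c i = t * ∑ i, x i * c i := by
        simp [Finset.mul_sum, mul_assoc]
      simp only [Set.mem_setOf_eq] at *
      rw [h, hx c hc, mul_zero] }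

/-- The code of matrices all of whose columns lie in `CA`. -/
def colCode {A : Type*} (B : Type*) (CA : Submodule (ZMod 2) (A → ZMod 2)) :
    Submodule (ZMod 2) (A × B → ZMod 2) where
  carrier := {x | ∀ b : B, (fun a => x (a, b)) ∈ CA}
  add_mem' := by intro x y hx hy b; exact CA.add_mem (hx b) (hy b)
  zero_mem' := by intro b; exact CA.zero_mem
  smul_mem' := by intro t x hx b; exact CA.smul_mem t (hx b)

/-- The code of matrices all of whose rows lie in `CB`. -/
def rowCode (A : Type*) {B : Type*} (CB : Submodule (ZMod 2) (B → ZMod 2)) :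
    Submodule (ZMod 2) (A × B → ZMod 2) where
  carrier := {x | ∀ a : A, (fun b => x (a, b)) ∈ CB}
  add_mem' := by intro x y hx hy a; exact CB.add_mem (hx a) (hy a)
  zero_mem' := by intro a; exact CB.zero_mem
  smul_mem' := by intro t x hx a; exact CB.smul_mem t (hx a)

/-- Tensor code `C_A ⊗ C_B`. -/
def tensorCode {A B : Type*} (CA : Submodule (ZMod 2) (A → ZMod 2))
    (CB : Submodule (ZMod 2) (B → ZMod 2)) : Submodule (ZMod 2) (A × B → ZMod 2) :=
  colCode B CA ⊓ rowCode A CB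

/-- Dual tensor code `C_A ⊗ F₂^B + F₂^A ⊗ C_B`. -/
def dualTensor {A B : Type*} (CA : Submodule (ZMod 2) (A → ZMod 2))
    (CB : Submodule (ZMod 2) (B → ZMod 2)) : Submodule (ZMod 2) (A × B → ZMod 2) :=
  colCode B CA ⊔ rowCode A CB

/-- `w`-robustness of the dual tensor code of `CA` and `CB`. -/
def IsRobust {A B : Type*} (CA : Submodule (ZMod 2) (A → ZMod 2))
    (CB : Submodule (ZMod 2) (B → ZMod 2)) (w : ℝ) : Prop :=
  ∀ c ∈ dualTensor CA CB, (wt c : ℝ) ≤ w →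
    ∃ (A' : Set A) (B' : Set B),
      (A'.ncard : ℝ) ≤ (wt c : ℝ) / (minDist CB : ℝ) ∧
      (B'.ncard : ℝ) ≤ (wt c : ℝ) / (minDist CA : ℝ) ∧
      ∀ a b, a ∉ A' → b ∉ B' → c (a, b) = 0

/-- Punctured code: restrictions of codewords of `C` to the coordinates in `A'`. -/
def punct {A : Type*} (C : Submodule (ZMod 2) (A → ZMod 2)) (A' : Set A) :
    Submodule (ZMod 2) (↥A' → ZMod 2) :=
  C.map (LinearMap.funLeft (ZMod 2) (ZMod 2) ((↑) : ↥A' → A))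

/-- `w`-robustness with `p`-resistance to puncturing. -/
def IsRobustPunct {A B : Type*} [Finite A] [Finite B]
    (CA : Submodule (ZMod 2) (A → ZMod 2)) (CB : Submodule (ZMod 2) (B → ZMod 2))
    (w p : ℝ) : Prop :=
  ∀ (A' : Set A) (B' : Set B) (w' : ℕ), (w' : ℝ) ≤ p →
    A'.ncard + w' = Nat.card A → B'.ncard + w' = Nat.card B →
    IsRobust (punct CA A') (punct CB B') w

section Complex

variable {G : Type*} [Group G] [DecidableEq G]

/-- Total no-conjugacy condition. -/
def TNC (A B : Set G) : Prop := ∀ g : G, ∀ a ∈ A, ∀ b ∈ B, a * g ≠ g * b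

/-- The square associated to `(g, a, b)`. -/
def cpxSq (g a b : G) : Finset (G × Bool) :=
  {(g, false), (a * g, true), (g * b, true), (a * g * b, false)}

/-- The set `Q` of squares of the left-right Cayley complex. -/
def Squares (A B : Set G) : Set (Finset (G × Bool)) :=
  {q | ∃ g : G, ∃ a ∈ A, ∃ b ∈ B, q = cpxSq g a b}

/-- Local view of `x : F₂^Q` at the vertex `(g, 0) ∈ V₀`, as an element of `F₂^{A×B}`. -/
def lview0 (A B : Set G) (x : ↥(Squares A B) → ZMod 2) (g : G) :
    ↥A × ↥B → ZMod 2 :=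
  fun ab => x ⟨cpxSq g (ab.1 : G) (ab.2 : G), ⟨g, (ab.1 : G), ab.1.2, (ab.2 : G), ab.2.2, rfl⟩⟩

/-- Local view of `x : F₂^Q` at the vertex `(g, 1) ∈ V₁`, as an element of `F₂^{A×B}`. -/
def lview1 {A B : Set G} (hA : ∀ a ∈ A, a⁻¹ ∈ A) (x : ↥(Squares A B) → ZMod 2) (g : G) :
    ↥A × ↥B → ZMod 2 :=
  fun ab => x ⟨cpxSq ((ab.1 : G) * g) (ab.1 : G)⁻¹ (ab.2 : G),
    ⟨(ab.1 : G) * g, (ab.1 : G)⁻¹, hA _ ab.1.2, (ab.2 : G), ab.2.2, rfl⟩⟩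

/-- The classical code 𝒞₀ of the quantum Tanner code: all local views at
vertices of `V₀` lie in `C₀^⊥ = (C_A ⊗ C_B)^⊥`. -/
def qC0 [Finite G] (A B : Set G) (CA : Submodule (ZMod 2) (↥A → ZMod 2))
    (CB : Submodule (ZMod 2) (↥B → ZMod 2)) :
    Submodule (ZMod 2) (↥(Squares A B) → ZMod 2) where
  carrier := {x | ∀ g : G, lview0 A B x g ∈ dualCode (tensorCode CA CB)}
  add_mem' := by
    intro x y hx hy g
    exact (dualCode (tensorCode CA CB)).add_mem (hx g) (hy g)
  zero_mem' := by
    intro g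
    exact (dualCode (tensorCode CA CB)).zero_mem
  smul_mem' := by
    intro t x hx g
    exact (dualCode (tensorCode CA CB)).smul_mem t (hx g)

/-- The classical code 𝒞₁ of the quantum Tanner code: all local views at
vertices of `V₁` lie in `C₁^⊥ = (C_A^⊥ ⊗ C_B^⊥)^⊥`. -/
def qC1 [Finite G] {A B : Set G} (hA : ∀ a ∈ A, a⁻¹ ∈ A)
    (CA : Submodule (ZMod 2) (↥A → ZMod 2)) (CB : Submodule (ZMod 2) (↥B → ZMod 2)) :
    Submodule (ZMod 2) (↥(Squares A B) → ZMod 2) where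
  carrier := {x | ∀ g : G, lview1 hA x g ∈ dualCode (tensorCode (dualCode CA) (dualCode CB))}
  add_mem' := by
    intro x y hx hy g
    exact (dualCode (tensorCode (dualCode CA) (dualCode CB))).add_mem (hx g) (hy g)
  zero_mem' := by
    intro g
    exact (dualCode (tensorCode (dualCode CA) (dualCode CB))).zero_mem
  smul_mem' := by
    intro t x hx g
    exact (dualCode (tensorCode (dualCode CA) (dualCode CB))).smul_mem t (hx g)

/-- Adjacency matrix of the left Cayley graph `Cay(G, A)`. -/
def cayAdjL (A : Set G) : Matrix G G ℝ :=
  fun g g' => A.indicator (fun _ => (1 : ℝ)) (g' * g⁻¹)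

/-- Adjacency matrix of the right Cayley graph `Cay(G, B)`. -/
def cayAdjR (B : Set G) : Matrix G G ℝ :=
  fun g g' => B.indicator (fun _ => (1 : ℝ)) (g⁻¹ * g')

end Complex

/-- A `Δ`-regular graph (given by its adjacency matrix) is Ramanujan if every
eigenvalue other than `±Δ` has absolute value at most `2√(Δ-1)`. -/
def IsRamanujan {V : Type*} [Fintype V] (M : Matrix V V ℝ) (Δ : ℝ) : Prop :=
  ∀ μ : ℝ, (∃ x : V → ℝ, x ≠ 0 ∧ M.mulVec x = μ • x) → μ ≠ Δ → μ ≠ -Δ →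
    |μ| ≤ 2 * Real.sqrt (Δ - 1)

/-- Probability of the event `S` under the uniform distribution on a finite type. -/
def unifProb {Ω : Type*} [Fintype Ω] (S : Set Ω) : ℝ :=
  (S.ncard : ℝ) / (Fintype.card Ω : ℝ)

end

section ColumnSupport

open Finset

lemma minDist_le_wt {ι : Type*} {C : Submodule (ZMod 2) (ι → ZMod 2)} {c : ι → ZMod 2}
    (hc : c ∈ C) (hc0 : c ≠ 0) : minDist C ≤ wt c :=
  Nat.sInf_le ⟨c, hc, hc0, rfl⟩

lemma wt_eq_card_filter {ι : Type*} [Fintype ι] (x : ι → ZMod 2) : wt x = #{i | x i ≠ 0} := by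
  rw [wt, ← Set.ncard_coe_finset]
  simp

variable {m n r : Type*} [Fintype m] [DecidableEq m]

/-- The rows in which some column of `X` indexed by `T` is nonzero. -/
def colSupport (X : Matrix m n (ZMod 2)) (T : Finset n) : Finset m :=
  T.biUnion fun j => {i | X i j ≠ 0}

lemma mem_colSupport {X : Matrix m n (ZMod 2)} {T : Finset n} {i : m} :
    i ∈ colSupport X T ↔ ∃ j ∈ T, X i j ≠ 0 := by
  simp [colSupport]

lemma card_colSupport_le {X : Matrix m n (ZMod 2)} {w : ℝ}
    (hcol : ∀ j, (wt (X.col j) : ℝ) ≤ w) (T : Finset n) :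
    (#(colSupport X T) : ℝ) ≤ #T * w := by
  calc (#(colSupport X T) : ℝ) ≤ ∑ j ∈ T, (wt (X.col j) : ℝ) := by
        simp_rw [wt_eq_card_filter]
        exact_mod_cast card_biUnion_le
    _ ≤ #T * w := by
        simpa using sum_le_card_nsmul T _ w fun j _ => hcol j

lemma card_colSupport_insert_le [DecidableEq n] (X : Matrix m n (ZMod 2)) (T : Finset n) (j : n) :
    #(colSupport X (insert j T)) ≤ wt (X.col j) + #(colSupport X T) := by
  rw [colSupport, biUnion_insert, wt_eq_card_filter]
  exact card_union_le _ _

lemma mem_colSupport_of_mem_span {X : Matrix m n (ZMod 2)} {T : Finset n} {x : m → ZMod 2}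
    (hx : x ∈ Submodule.span (ZMod 2) (X.col '' T)) {i : m} (hi : x i ≠ 0) :
    i ∈ colSupport X T := by
  by_contra h
  have hle : Submodule.span (ZMod 2) (X.col '' T) ≤
      LinearMap.ker (LinearMap.proj (R := ZMod 2) (φ := fun _ : m => ZMod 2) i) := by
    rw [Submodule.span_le]
    rintro _ ⟨j, hj, rfl⟩
    by_contra hne
    exact h (mem_colSupport.2 ⟨j, hj, hne⟩)
  exact hi (hle hx)

/-- If the supports of linearly independent columns of `X` jointly have size less than the minimum
distance of `ker H`, then these columns remain independent after multiplication by `H`. -/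
lemma card_le_rank_mul [Fintype n] [Finite r] {H : Matrix r m (ZMod 2)}
    {X : Matrix m n (ZMod 2)} {T : Finset n} (hT : LinearIndepOn (ZMod 2) X.col (T : Set n))
    (hlt : #(colSupport X T) < minDist (LinearMap.ker H.mulVecLin)) :
    #T ≤ (H * X).rank := by
  have hdisj : Disjoint (Submodule.span (ZMod 2) (X.col '' T)) (LinearMap.ker H.mulVecLin) := by
    rw [Submodule.disjoint_def]
    intro x hx hker
    by_contra hx0
    have hsub : wt x ≤ #(colSupport X T) := by
      rw [wt_eq_card_filter]
      exact card_le_card fun i hi => mem_colSupport_of_mem_span hx (by simpa using hi)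
    exact absurd (minDist_le_wt hker hx0) (by lia)
  have hli : LinearIndependent (ZMod 2) fun j : T => (H * X).col j := by
    rw [Set.image_eq_range] at hdisj
    have himage := LinearIndependent.map (v := fun j : T => X.col j) hT hdisj
    exact himage
  have hcols : Set.range (fun j : T => (H * X).col j) ⊆ Set.range (H * X).col :=
    Set.range_subset_iff.2 fun j => Set.mem_range_self (j : n)
  calc #T = Fintype.card T := (Fintype.card_coe T).symm
    _ = Module.finrank (ZMod 2) (Submodule.span (ZMod 2)
          (Set.range fun j : T => (H * X).col j)) := (finrank_span_eq_card hli).symm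
    _ ≤ Module.finrank (ZMod 2) (Submodule.span (ZMod 2) (Set.range (H * X).col)) :=
        Submodule.finrank_mono (Submodule.span_mono hcols)
    _ = (H * X).rank := (H * X).rank_eq_finrank_span_cols.symm

/-- Among the sets of independent columns with joint support smaller than `d`, a maximal one either
has support almost `d` or covers every nonzero row. -/
lemma exists_linearIndepOn_colSupport [Finite n] (X : Matrix m n (ZMod 2)) {w d : ℝ} (hd : 0 < d)
    (hcol : ∀ j, (wt (X.col j) : ℝ) ≤ w) :
    ∃ T : Finset n, LinearIndepOn (ZMod 2) X.col (T : Set n) ∧ (#(colSupport X T) : ℝ) < d ∧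
      (d - w ≤ #(colSupport X T) ∨ ∀ i j, X i j ≠ 0 → i ∈ colSupport X T) := by
  classical
  obtain ⟨T, ⟨hT, hTd⟩, hmax⟩ := (Set.toFinite {T : Finset n |
    LinearIndepOn (ZMod 2) X.col (T : Set n) ∧ (#(colSupport X T) : ℝ) < d}).exists_maximal
    ⟨∅, by simp [colSupport, hd]⟩
  refine ⟨T, hT, hTd, or_iff_not_imp_right.2 fun h => ?_⟩
  push Not at h
  obtain ⟨i, j, hij, hi⟩ := h
  have hjT : j ∉ T := fun hj => hi (mem_colSupport.2 ⟨j, hj, hij⟩)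
  have hspan : X.col j ∉ Submodule.span (ZMod 2) (X.col '' T) := fun hmem =>
    hi (mem_colSupport_of_mem_span hmem hij)
  have hge : d ≤ #(colSupport X (insert j T)) := by
    by_contra! hlt
    refine hjT (hmax ⟨?_, hlt⟩ (subset_insert j T) (mem_insert_self j T))
    rw [coe_insert, linearIndepOn_insert (by simpa using hjT)]
    exact ⟨hT, hspan⟩
  have hle : (#(colSupport X (insert j T)) : ℝ) ≤ wt (X.col j) + #(colSupport X T) :=
    mod_cast card_colSupport_insert_le X T j
  linarith [hcol j]

end ColumnSupport

/-- Corollary 7: the syndrome matrix `H_A · X` of a matrix with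
light columns and many nonzero rows has large rank. -/
theorem syndrome_matrix_rank_bound
    (Δ n rA : ℕ) (hΔ : 2 ≤ Δ) (hn : 0 < n) (α : ℝ) (hα : 0 < α)
    (d : ℝ) (hd : 2 * α * Δ + 2 * Real.sqrt Δ / Real.logb 2 Δ ≤ d)
    (HA : Matrix (Fin rA) (Fin Δ) (ZMod 2))
    (hdA : d ≤ (minDist (LinearMap.ker HA.mulVecLin) : ℝ))
    (X : Matrix (Fin Δ) (Fin n) (ZMod 2))
    (hcol : ∀ j : Fin n, (wt (fun i => X i j) : ℝ) ≤ Real.sqrt Δ / Real.logb 2 Δ)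
    (hrows : d / 2 ≤ (({i : Fin Δ | ∃ j, X i j ≠ 0}).ncard : ℝ)) :
    α * Real.sqrt Δ * Real.logb 2 Δ ≤ ((HA * X).rank : ℝ) := by
  have hlog : 0 < Real.logb 2 Δ := Real.logb_pos (by norm_num) (by exact_mod_cast hΔ)
  have hsq : 0 < Real.sqrt Δ := Real.sqrt_pos.2 (by positivity)
  have hw : 0 < Real.sqrt Δ / Real.logb 2 Δ := div_pos hsq hlog
  have hαΔ : 0 < α * Δ := by positivity
  rw [mul_div_assoc] at hd
  obtain ⟨T, hT, hTd, hcov⟩ := exists_linearIndepOn_colSupport X (d := d) (by linarith) hcol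
  have hlarge : α * Δ ≤ (colSupport X T).card := by
    rcases hcov with h | h
    · linarith
    · have hsub : {i : Fin Δ | ∃ j, X i j ≠ 0}.ncard ≤ (colSupport X T).card := by
        rw [← Set.ncard_coe_finset]
        exact Set.ncard_le_ncard fun i ⟨j, hij⟩ => h i j hij
      have : ({i : Fin Δ | ∃ j, X i j ≠ 0}.ncard : ℝ) ≤ (colSupport X T).card := mod_cast hsub
      linarith
  have hrank : (T.card : ℝ) ≤ (HA * X).rank :=
    mod_cast card_le_rank_mul hT (mod_cast hTd.trans_le hdA)
  refine le_trans (le_of_mul_le_mul_right ?_ hw) hrank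
  calc α * Real.sqrt Δ * Real.logb 2 Δ * (Real.sqrt Δ / Real.logb 2 Δ)
      = α * (Real.sqrt Δ * Real.sqrt Δ) := by field_simp
    _ = α * Δ := by rw [Real.mul_self_sqrt (by positivity)]
    _ ≤ T.card * (Real.sqrt Δ / Real.logb 2 Δ) := hlarge.trans (card_colSupport_le hcol T)
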